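/- For every q ∈ [2,∞) there exists a constant c_q > 0, depending only on q, such that for every summable f : ℤ → ℝ, ‖G_*(f)‖_q ≤ c_q ‖f‖_q, where G_*(f)(x) = (∫₀^∞ Σ_{y,z∈ℤ} |P_t f(z+y) − P_t f(z)|² · p_t(x,z) · K_s(y) dt)^{1/2}. -/

import Mathlib

open MeasureTheory Real

/-- The kernel `K_s` of the fractional discrete Laplacian on `ℤ`. -/
noncomputable def Ker (s : ℝ) (m : ℤ) : ℝ :=
  if m = 0 then 0
  else ((4 : ℝ) ^ s * Real.Gamma (1 / 2 + s) / (Real.sqrt Real.pi * |Real.Gamma (-s)|)) *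
    (Real.Gamma ((m.natAbs : ℝ) - s) / Real.Gamma ((m.natAbs : ℝ) + 1 + s))

/-- The fractional discrete Laplacian `L = (-Δ)^s` acting pointwise. -/
noncomputable def Lop (s : ℝ) (f : ℤ → ℝ) : ℤ → ℝ :=
  fun x => ∑' y : ℤ, (f x - f y) * Ker s (x - y)

/-- The heat semigroup `P_t = exp (-t L)`, given by the exponential series of the
bounded operator `-tL` (evaluated pointwise). -/
noncomputable def heat (s t : ℝ) (f : ℤ → ℝ) : ℤ → ℝ :=
  fun x => ∑' n : ℕ, ((-t) ^ n / (n.factorial : ℝ)) * ((Lop s)^[n] f x)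

/-- The squared modulus of the gradient, `|∇f|²(x) = Σ_y K_s(y-x) (f x - f y)²`. -/
noncomputable def gradSq (s : ℝ) (f : ℤ → ℝ) (x : ℤ) : ℝ :=
  ∑' y : ℤ, Ker s (y - x) * (f x - f y) ^ 2

/-- The squared modulus of the modified gradient,
`|∇̃f|²(x) = Σ_{y : |f y| < |f x|} K_s(y-x) (f x - f y)²`. -/
noncomputable def mgradSq (s : ℝ) (f : ℤ → ℝ) (x : ℤ) : ℝ :=
  ∑' y : {y : ℤ // |f y| < |f x|}, Ker s ((y : ℤ) - x) * (f x - f (y : ℤ)) ^ 2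

/-- The `ℓ^q` norm on `ℤ` with counting measure (for finite `q`). -/
noncomputable def lqNorm (q : ℝ) (f : ℤ → ℝ) : ℝ :=
  (∑' x : ℤ, |f x| ^ q) ^ (1 / q)

/-- The heat kernel `p_t(x,z) = (P_t δ_z)(x)`. -/
noncomputable def hker (s t : ℝ) (x z : ℤ) : ℝ :=
  heat s t (fun y => if y = z then (1 : ℝ) else 0) x

/-! ### The kernel -/

lemma Ker_neg (s : ℝ) (m : ℤ) : Ker s (-m) = Ker s m := by
  simp [Ker]

lemma Ker_sub_comm (s : ℝ) (x y : ℤ) : Ker s (x - y) = Ker s (y - x) := by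
  rw [← Ker_neg, neg_sub]

lemma Ker_nonneg {s : ℝ} (hs : s ∈ Set.Ioo (0 : ℝ) 1) (m : ℤ) : 0 ≤ Ker s m := by
  obtain ⟨h0, h1⟩ := hs
  unfold Ker
  split_ifs with hm
  · exact le_rfl
  have hn : (1 : ℝ) ≤ m.natAbs := by exact_mod_cast Int.natAbs_pos.mpr hm
  have e1 := Gamma_pos_of_pos (s := 1 / 2 + s) (by linarith)
  have e2 := Gamma_pos_of_pos (s := (m.natAbs : ℝ) - s) (by linarith)
  have e3 := Gamma_pos_of_pos (s := (m.natAbs : ℝ) + 1 + s) (by linarith)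
  positivity

/-- The Gamma quotients in the kernel telescope. -/
lemma summable_Gamma_quotient {s : ℝ} (hs : s ∈ Set.Ioo (0 : ℝ) 1) :
    Summable fun n : ℕ => Gamma (((n + 1 : ℕ) : ℝ) - s) / Gamma (((n + 1 : ℕ) : ℝ) + 1 + s) := by
  obtain ⟨h0, h1⟩ := hs
  set a : ℕ → ℝ := fun n => Gamma (((n + 1 : ℕ) : ℝ) - s) / Gamma (((n + 1 : ℕ) : ℝ) + s) with ha
  have ha0 : ∀ n, 0 ≤ a n := fun n => by
    have hn : (1 : ℝ) ≤ ((n + 1 : ℕ) : ℝ) := by exact_mod_cast Nat.le_add_left 1 n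
    exact div_nonneg (Gamma_pos_of_pos (by linarith)).le (Gamma_pos_of_pos (by linarith)).le
  have key : ∀ n : ℕ, Gamma (((n + 1 : ℕ) : ℝ) - s) / Gamma (((n + 1 : ℕ) : ℝ) + 1 + s) =
      (a n - a (n + 1)) / (2 * s) := fun n => by
    have hn : (1 : ℝ) ≤ ((n + 1 : ℕ) : ℝ) := by exact_mod_cast Nat.le_add_left 1 n
    have e1 : Gamma (((n + 1 + 1 : ℕ) : ℝ) - s) =
        (((n + 1 : ℕ) : ℝ) - s) * Gamma (((n + 1 : ℕ) : ℝ) - s) := by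
      rw [← Gamma_add_one (by linarith)]; push_cast; ring_nf
    have e2 : Gamma (((n + 1 + 1 : ℕ) : ℝ) + s) =
        (((n + 1 : ℕ) : ℝ) + s) * Gamma (((n + 1 : ℕ) : ℝ) + s) := by
      rw [← Gamma_add_one (by linarith)]; push_cast; ring_nf
    have e3 : Gamma (((n + 1 : ℕ) : ℝ) + 1 + s) =
        (((n + 1 : ℕ) : ℝ) + s) * Gamma (((n + 1 : ℕ) : ℝ) + s) := by
      rw [← Gamma_add_one (by linarith)]; ring_nf
    have hG : Gamma (((n + 1 : ℕ) : ℝ) + s) ≠ 0 := (Gamma_pos_of_pos (by linarith)).ne'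
    have hne : ((n + 1 : ℕ) : ℝ) + s ≠ 0 := by linarith
    simp only [ha]
    rw [e1, e2, e3]
    field_simp
    ring
  refine summable_of_sum_range_le (c := a 0 / (2 * s)) (fun n => ?_) fun n => ?_
  · have hn : (1 : ℝ) ≤ ((n + 1 : ℕ) : ℝ) := by exact_mod_cast Nat.le_add_left 1 n
    exact div_nonneg (Gamma_pos_of_pos (by linarith)).le (Gamma_pos_of_pos (by linarith)).le
  · rw [Finset.sum_congr rfl fun n _ => key n, ← Finset.sum_div, Finset.sum_range_sub']
    have := ha0 n
    gcongr
    linarith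

lemma Ker_summable {s : ℝ} (hs : s ∈ Set.Ioo (0 : ℝ) 1) : Summable (Ker s) := by
  have h : Summable fun n : ℕ => Ker s (n : ℤ) := by
    rw [← summable_nat_add_iff 1]
    refine ((summable_Gamma_quotient hs).mul_left
      ((4 : ℝ) ^ s * Gamma (1 / 2 + s) / (√π * |Gamma (-s)|))).congr fun n => ?_
    have hn : ((n + 1 : ℕ) : ℤ) ≠ 0 := by omega
    rw [Ker, if_neg hn, Int.natAbs_natCast]
  refine Summable.of_nat_of_neg h ?_
  simpa only [Ker_neg] using h

/-! ### The semigroup on `ℓ¹(ℤ)` -/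

/-- The Banach space `ℓ¹(ℤ)`. -/
abbrev EllOne := lp (fun _ : ℤ => ℝ) 1

lemma memℓp_one_iff {f : ℤ → ℝ} : Memℓp f 1 ↔ Summable fun x => |f x| := by
  rw [memℓp_gen_iff (by simp)]
  simp

lemma EllOne.summable_abs (F : EllOne) : Summable fun x => |F x| := memℓp_one_iff.1 (lp.memℓp F)

lemma EllOne.norm_eq (F : EllOne) : ‖F‖ = ∑' x, |F x| := by
  rw [lp.norm_eq_tsum_rpow (by simp)]
  simp

lemma EllOne.abs_apply_le (F : EllOne) (x : ℤ) : |F x| ≤ ‖F‖ :=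
  lp.norm_apply_le_norm (by simp) F x

/-- The automorphism `(x, y) ↦ (x - y, y)` of `ℤ × ℤ`. -/
def subLeftEquiv : ℤ × ℤ ≃ ℤ × ℤ where
  toFun p := (p.1 - p.2, p.2)
  invFun p := (p.1 + p.2, p.2)
  left_inv p := by simp
  right_inv p := by simp

/-- A bounded function times `K_s(x - y) g(y)` is summable over pairs. -/
lemma summable_bdd_mul_Ker {s : ℝ} (hs : s ∈ Set.Ioo (0 : ℝ) 1) {g : ℤ → ℝ}
    (hg : Summable fun x => |g x|) {b : ℤ × ℤ → ℝ} {C : ℝ} (hb : ∀ p, |b p| ≤ C) :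
    Summable fun p : ℤ × ℤ => b p * (Ker s (p.1 - p.2) * g p.2) := by
  have h : Summable fun p : ℤ × ℤ => Ker s (p.1 - p.2) * |g p.2| :=
    (subLeftEquiv.summable_iff (f := fun p : ℤ × ℤ => Ker s p.1 * |g p.2|)).2
      ((Ker_summable hs).mul_of_nonneg hg (Ker_nonneg hs) fun _ => abs_nonneg _)
  refine Summable.of_norm_bounded (h.mul_left C) fun p => ?_
  rw [norm_mul, norm_mul, Real.norm_of_nonneg (Ker_nonneg hs _)]
  exact mul_le_mul_of_nonneg_right (hb p) (mul_nonneg (Ker_nonneg hs _) (abs_nonneg _))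

lemma summable_Ker_mul {s : ℝ} (hs : s ∈ Set.Ioo (0 : ℝ) 1) {g : ℤ → ℝ}
    (hg : Summable fun x => |g x|) :
    Summable fun p : ℤ × ℤ => Ker s (p.1 - p.2) * g p.2 := by
  simpa using summable_bdd_mul_Ker hs hg (b := fun _ => 1) (C := 1) (by simp)

lemma summable_Ker_mul_right {s : ℝ} (hs : s ∈ Set.Ioo (0 : ℝ) 1) {g : ℤ → ℝ}
    (hg : Summable fun x => |g x|) (x : ℤ) : Summable fun y => Ker s (x - y) * g y :=
  (summable_Ker_mul hs hg).prod_factor x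

lemma summable_Ker_sub_left {s : ℝ} (hs : s ∈ Set.Ioo (0 : ℝ) 1) (x : ℤ) :
    Summable fun y => Ker s (x - y) :=
  ((Equiv.subLeft x).summable_iff (f := Ker s)).2 (Ker_summable hs)

lemma tsum_Ker_sub_left (s : ℝ) (x : ℤ) : ∑' y, Ker s (x - y) = ∑' m, Ker s m :=
  (Equiv.subLeft x).tsum_eq (Ker s)

lemma tsum_Ker_mul {s : ℝ} (hs : s ∈ Set.Ioo (0 : ℝ) 1) {g : ℤ → ℝ}
    (hg : Summable fun x => |g x|) :
    ∑' x, ∑' y, Ker s (x - y) * g y = (∑' m, Ker s m) * ∑' x, g x := by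
  have h := summable_Ker_mul hs hg
  have hc : ∑' x, ∑' y, Ker s (x - y) * g y = ∑' y, ∑' x, Ker s (x - y) * g y :=
    (Summable.tsum_comm (f := fun x y => Ker s (x - y) * g y) h).symm
  rw [hc, ← tsum_mul_left]
  refine tsum_congr fun y => ?_
  rw [tsum_mul_right]
  congr 1
  exact (Equiv.subRight y).tsum_eq (Ker s)

lemma abs_tsum_Ker_mul_le {s : ℝ} (hs : s ∈ Set.Ioo (0 : ℝ) 1) {g : ℤ → ℝ}
    (hg : Summable fun x => |g x|) (x : ℤ) :
    |∑' y, Ker s (x - y) * g y| ≤ ∑' y, Ker s (x - y) * |g y| := by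
  have h := summable_Ker_mul_right hs (g := fun y => |g y|) (by simpa using hg) x
  rw [← Real.norm_eq_abs]
  refine tsum_of_norm_bounded h.hasSum fun y => ?_
  rw [norm_mul, Real.norm_of_nonneg (Ker_nonneg hs _), Real.norm_eq_abs]

lemma summable_abs_tsum_Ker_mul {s : ℝ} (hs : s ∈ Set.Ioo (0 : ℝ) 1) {g : ℤ → ℝ}
    (hg : Summable fun x => |g x|) : Summable fun x => |∑' y, Ker s (x - y) * g y| :=
  Summable.of_nonneg_of_le (fun _ => abs_nonneg _) (abs_tsum_Ker_mul_le hs hg)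
    (summable_Ker_mul hs (g := fun y => |g y|) (by simpa using hg)).prod

/-- Convolution with `K_s` as a bounded operator on `ℓ¹(ℤ)`. -/
noncomputable def convKer {s : ℝ} (hs : s ∈ Set.Ioo (0 : ℝ) 1) : EllOne →L[ℝ] EllOne :=
  LinearMap.mkContinuous
    { toFun := fun F => ⟨fun x => ∑' y, Ker s (x - y) * F y,
        memℓp_one_iff.2 (summable_abs_tsum_Ker_mul hs (EllOne.summable_abs F))⟩
      map_add' := fun F G => by
        ext x
        simp only [lp.coeFn_add, Pi.add_apply, mul_add]
        exact (summable_Ker_mul_right hs (EllOne.summable_abs F) x).tsum_add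
          (summable_Ker_mul_right hs (EllOne.summable_abs G) x)
      map_smul' := fun c F => by
        ext x
        simp only [lp.coeFn_smul, Pi.smul_apply, smul_eq_mul, RingHom.id_apply, ← tsum_mul_left]
        exact tsum_congr fun y => by ring }
    (∑' m, Ker s m) fun F => by
      have h : Summable fun x => |(|F x|)| := by simpa using EllOne.summable_abs F
      rw [EllOne.norm_eq, EllOne.norm_eq, ← tsum_Ker_mul hs h]
      exact (summable_abs_tsum_Ker_mul hs (EllOne.summable_abs F)).tsum_le_tsum
        (abs_tsum_Ker_mul_le hs (EllOne.summable_abs F)) (summable_Ker_mul hs h).prod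

lemma convKer_apply {s : ℝ} (hs : s ∈ Set.Ioo (0 : ℝ) 1) (F : EllOne) (x : ℤ) :
    convKer hs F x = ∑' y, Ker s (x - y) * F y := rfl

/-- The operator `L = (-Δ)^s` on `ℓ¹(ℤ)`. -/
noncomputable def lapOp {s : ℝ} (hs : s ∈ Set.Ioo (0 : ℝ) 1) : EllOne →L[ℝ] EllOne :=
  (∑' m, Ker s m) • (1 : EllOne →L[ℝ] EllOne) - convKer hs

lemma lapOp_apply {s : ℝ} (hs : s ∈ Set.Ioo (0 : ℝ) 1) (F : EllOne) (x : ℤ) :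
    lapOp hs F x = (∑' m, Ker s m) * F x - ∑' y, Ker s (x - y) * F y := by
  rfl

lemma coe_lapOp {s : ℝ} (hs : s ∈ Set.Ioo (0 : ℝ) 1) (F : EllOne) :
    (lapOp hs F : ℤ → ℝ) = Lop s F := by
  ext x
  have h := ((summable_Ker_sub_left hs x).mul_left (F x)).tsum_sub
    (summable_Ker_mul_right hs (EllOne.summable_abs F) x)
  rw [tsum_mul_left, tsum_Ker_sub_left, mul_comm] at h
  rw [lapOp_apply, Lop, ← h]
  exact tsum_congr fun y => by ring

lemma coe_lapOp_pow {s : ℝ} (hs : s ∈ Set.Ioo (0 : ℝ) 1) (F : EllOne) (n : ℕ) :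
    (((lapOp hs ^ n) F : EllOne) : ℤ → ℝ) = (Lop s)^[n] F := by
  induction n with
  | zero => rfl
  | succ n ih => rw [pow_succ', mul_apply_eq_comp, coe_lapOp, ih,
      Function.iterate_succ_apply']

/-- The heat semigroup `exp(-tL)` as an operator on `ℓ¹(ℤ)`. -/
noncomputable def heatOp {s : ℝ} (hs : s ∈ Set.Ioo (0 : ℝ) 1) (t : ℝ) : EllOne →L[ℝ] EllOne :=
  NormedSpace.exp (t • (-lapOp hs))

/-- Pointwise evaluation of the exponential series of an operator. -/
lemma hasSum_exp_apply (A : EllOne →L[ℝ] EllOne) (F : EllOne) (x : ℤ) :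
    HasSum (fun n : ℕ => ((n.factorial : ℝ)⁻¹) * ((A ^ n) F : EllOne) x)
      ((NormedSpace.exp A F : EllOne) x) := by
  have h := NormedSpace.exp_series_hasSum_exp' (𝕂 := ℝ) A
  have h2 := (h.mapL (ContinuousLinearMap.apply ℝ EllOne F)).mapL
    (lp.evalCLM (𝕜 := ℝ) (fun _ : ℤ => ℝ) 1 x)
  exact h2

lemma hasSum_heatOp {s : ℝ} (hs : s ∈ Set.Ioo (0 : ℝ) 1) (t : ℝ) (F : EllOne) (x : ℤ) :
    HasSum (fun n : ℕ => (-t) ^ n / (n.factorial : ℝ) * ((lapOp hs ^ n) F : EllOne) x)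
      ((heatOp hs t F : EllOne) x) := by
  refine (hasSum_exp_apply (t • (-lapOp hs)) F x).congr_fun fun n => ?_
  rw [smul_neg, ← neg_smul, smul_pow]
  simp only [smul_apply, lp.coeFn_smul, Pi.smul_apply, smul_eq_mul]
  ring

lemma heat_eq {s : ℝ} (hs : s ∈ Set.Ioo (0 : ℝ) 1) (t : ℝ) (F : EllOne) (x : ℤ) :
    heat s t F x = (heatOp hs t F : EllOne) x := by
  rw [← (hasSum_heatOp hs t F x).tsum_eq, heat]
  simp only [coe_lapOp_pow]

lemma hasDerivAt_heatOp {s : ℝ} (hs : s ∈ Set.Ioo (0 : ℝ) 1) (F : EllOne) (x : ℤ) (t : ℝ) :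
    HasDerivAt (fun t => (heatOp hs t F : EllOne) x)
      (-(lapOp hs (heatOp hs t F) : EllOne) x) t := by
  have h := hasDerivAt_exp_smul_const' (𝕂 := ℝ) (-lapOp hs) t
  have h2 := ((lp.evalCLM (𝕜 := ℝ) (fun _ : ℤ => ℝ) 1 x).comp
    (ContinuousLinearMap.apply ℝ EllOne F)).hasFDerivAt.comp_hasDerivAt t h
  exact h2

lemma lapOp_heatOp_comm {s : ℝ} (hs : s ∈ Set.Ioo (0 : ℝ) 1) (F : EllOne) (t : ℝ) :
    lapOp hs (heatOp hs t F) = heatOp hs t (lapOp hs F) := by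
  have h : Commute (lapOp hs) (heatOp hs t) :=
    (((Commute.refl (lapOp hs)).neg_right).smul_right t).exp_right
  exact congrArg (fun A : EllOne →L[ℝ] EllOne => A F) h.eq

lemma heatOp_zero {s : ℝ} (hs : s ∈ Set.Ioo (0 : ℝ) 1) (F : EllOne) : heatOp hs 0 F = F := by
  simp [heatOp]

/-- Over a bounded range of times the semigroup has a summable majorant. -/
lemma exists_heatOp_majorant {s : ℝ} (hs : s ∈ Set.Ioo (0 : ℝ) 1) (F : EllOne) (R : ℝ) :
    ∃ m : ℤ → ℝ, Summable m ∧ ∀ t, |t| ≤ R → ∀ x, |(heatOp hs t F : EllOne) x| ≤ m x := by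
  set g : ℕ × ℤ → ℝ := fun p =>
    |R| ^ p.1 / (p.1.factorial : ℝ) * |((lapOp hs ^ p.1) F : EllOne) p.2| with hg
  have hs1 : ∀ n, Summable fun x => g (n, x) := fun n => by
    simp only [hg]
    exact (EllOne.summable_abs ((lapOp hs ^ n) F)).mul_left (|R| ^ n / (n.factorial : ℝ))
  have hpow : ∀ n, ‖(lapOp hs ^ n) F‖ ≤ ‖lapOp hs‖ ^ n * ‖F‖ := fun n => by
    induction n with
    | zero => simp
    | succ n ih =>
      rw [pow_succ', mul_apply_eq_comp, pow_succ', mul_assoc]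
      exact (lapOp hs).le_opNorm_of_le ih
  have hS : Summable g := by
    refine (summable_prod_of_nonneg fun p => by positivity).2 ⟨hs1, ?_⟩
    simp only [hg, tsum_mul_left, ← EllOne.norm_eq]
    refine Summable.of_nonneg_of_le (fun n => by positivity) (fun n => ?_)
      ((Real.summable_pow_div_factorial (|R| * ‖lapOp hs‖)).mul_right ‖F‖)
    calc |R| ^ n / (n.factorial : ℝ) * ‖(lapOp hs ^ n) F‖
        ≤ |R| ^ n / (n.factorial : ℝ) * (‖lapOp hs‖ ^ n * ‖F‖) := by
          gcongr
          exact hpow n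
      _ = _ := by rw [mul_pow]; ring
  refine ⟨fun x => ∑' n, g (n, x), hS.prod_symm.prod, fun t ht x => ?_⟩
  rw [← (hasSum_heatOp hs t F x).tsum_eq, ← Real.norm_eq_abs]
  refine tsum_of_norm_bounded (hS.prod_symm.prod_factor x).hasSum fun n => ?_
  simp only [hg, Prod.swap_prod_mk]
  rw [norm_mul, norm_div, norm_pow, norm_neg, Real.norm_eq_abs, Real.norm_eq_abs, Real.norm_eq_abs,
    Nat.abs_cast]
  exact mul_le_mul_of_nonneg_right (div_le_div_of_nonneg_right
    (pow_le_pow_left₀ (abs_nonneg t) (ht.trans (le_abs_self R)) n) (by positivity)) (abs_nonneg _)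

/-! ### Positivity and contractivity -/

lemma convKer_pow_nonneg {s : ℝ} (hs : s ∈ Set.Ioo (0 : ℝ) 1) {F : EllOne} (hF : ∀ x, 0 ≤ F x)
    (n : ℕ) (x : ℤ) : 0 ≤ ((convKer hs ^ n) F : EllOne) x := by
  induction n generalizing x with
  | zero => exact hF x
  | succ n ih =>
    rw [pow_succ', mul_apply_eq_comp, convKer_apply]
    exact tsum_nonneg fun y => mul_nonneg (Ker_nonneg hs _) (ih y)

lemma convKer_pow_le {s : ℝ} (hs : s ∈ Set.Ioo (0 : ℝ) 1) {F : EllOne} {M : ℝ}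
    (hF : ∀ x, F x ≤ M) (n : ℕ) (x : ℤ) :
    ((convKer hs ^ n) F : EllOne) x ≤ (∑' m, Ker s m) ^ n * M := by
  induction n generalizing x with
  | zero => simpa using hF x
  | succ n ih =>
    rw [pow_succ', mul_apply_eq_comp, convKer_apply, pow_succ', mul_assoc,
      ← tsum_Ker_sub_left s x, ← tsum_mul_right]
    exact (summable_Ker_mul_right hs (EllOne.summable_abs _) x).tsum_le_tsum
      (fun y => mul_le_mul_of_nonneg_left ((ih y).trans_eq (by rw [tsum_Ker_sub_left]))
        (Ker_nonneg hs _))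
      ((summable_Ker_sub_left hs x).mul_right _)

lemma heatOp_eq {s : ℝ} (hs : s ∈ Set.Ioo (0 : ℝ) 1) (t : ℝ) (F : EllOne) :
    heatOp hs t F =
      Real.exp (-(t * ∑' m, Ker s m)) • NormedSpace.exp (t • convKer hs) F := by
  have h : t • (-lapOp hs) = algebraMap ℝ (EllOne →L[ℝ] EllOne) (-(t * ∑' m, Ker s m)) +
      t • convKer hs := by
    rw [lapOp, Algebra.algebraMap_eq_smul_one]
    module
  let _ : NormedAlgebra ℚ (EllOne →L[ℝ] EllOne) := .restrictScalars ℚ ℝ _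
  have hc := NormedSpace.exp_add_of_commute (Algebra.commute_algebraMap_left
    (-(t * ∑' m, Ker s m)) (t • convKer hs))
  rw [heatOp, h, hc, ← NormedSpace.algebraMap_exp_comm, Algebra.algebraMap_eq_smul_one,
    ← Real.exp_eq_exp_ℝ]
  simp

lemma heatOp_nonneg {s : ℝ} (hs : s ∈ Set.Ioo (0 : ℝ) 1) {t : ℝ} (ht : 0 ≤ t) {F : EllOne}
    (hF : ∀ x, 0 ≤ F x) (x : ℤ) : 0 ≤ (heatOp hs t F : EllOne) x := by
  rw [heatOp_eq, lp.coeFn_smul, Pi.smul_apply, smul_eq_mul,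
    ← (hasSum_exp_apply (t • convKer hs) F x).tsum_eq]
  refine mul_nonneg (Real.exp_pos _).le (tsum_nonneg fun n => ?_)
  have := convKer_pow_nonneg hs hF n x
  rw [smul_pow, smul_apply, lp.coeFn_smul, Pi.smul_apply, smul_eq_mul]
  positivity

lemma heatOp_le {s : ℝ} (hs : s ∈ Set.Ioo (0 : ℝ) 1) {t : ℝ} (ht : 0 ≤ t) {F : EllOne} {M : ℝ}
    (hF : ∀ x, F x ≤ M) (x : ℤ) : (heatOp hs t F : EllOne) x ≤ M := by
  rw [heatOp_eq, lp.coeFn_smul, Pi.smul_apply, smul_eq_mul]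
  have hle : ((NormedSpace.exp (t • convKer hs) F : EllOne) x) ≤
      Real.exp (t * ∑' m, Ker s m) * M := by
    have hE : HasSum (fun n : ℕ => (t * ∑' m, Ker s m) ^ n / (n.factorial : ℝ) * M)
        (Real.exp (t * ∑' m, Ker s m) * M) := by
      rw [Real.exp_eq_exp_ℝ]
      exact (NormedSpace.expSeries_div_hasSum_exp (𝔸 := ℝ) _).mul_right M
    refine hasSum_le (fun n => ?_) (hasSum_exp_apply (t • convKer hs) F x) hE
    rw [smul_pow, smul_apply, lp.coeFn_smul, Pi.smul_apply, smul_eq_mul]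
    calc ((n.factorial : ℝ)⁻¹) * (t ^ n * ((convKer hs ^ n) F : EllOne) x)
        ≤ ((n.factorial : ℝ)⁻¹) * (t ^ n * ((∑' m, Ker s m) ^ n * M)) := by
          gcongr
          exact convKer_pow_le hs hF n x
      _ = _ := by rw [mul_pow]; ring
  calc Real.exp (-(t * ∑' m, Ker s m)) * (NormedSpace.exp (t • convKer hs) F : EllOne) x
      ≤ Real.exp (-(t * ∑' m, Ker s m)) * (Real.exp (t * ∑' m, Ker s m) * M) := by gcongr
    _ = M := by rw [← mul_assoc, ← Real.exp_add]; simp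

/-! ### Bellman functions -/

/-- A function `B(u, v)` with partial derivatives `B₁`, `B₂` whose gradient is monotone, with a
lower bound `c (v + v') (u - u')²`, for `v, v' ∈ [0, M]`. -/
structure IsBellman (c M : ℝ) (B B₁ B₂ : ℝ → ℝ → ℝ) : Prop where
  nonneg : ∀ u v, 0 ≤ v → 0 ≤ B u v
  deriv : ∀ (u v : ℝ → ℝ) (u' v' t : ℝ), HasDerivAt u u' t → HasDerivAt v v' t →
    HasDerivAt (fun τ => B (u τ) (v τ)) (B₁ (u t) (v t) * u' + B₂ (u t) (v t) * v') t
  continuous₁ : Continuous fun p : ℝ × ℝ => B₁ p.1 p.2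
  continuous₂ : Continuous fun p : ℝ × ℝ => B₂ p.1 p.2
  monotone : ∀ u u' v v', v ∈ Set.Icc 0 M → v' ∈ Set.Icc 0 M →
    c * ((v + v') * (u - u') ^ 2) ≤
      (B₁ u v - B₁ u' v') * (u - u') + (B₂ u v - B₂ u' v') * (v - v')

lemma isBellman_sq : IsBellman 1 1 (fun u _ => u ^ 2) (fun u _ => 2 * u) (fun _ _ => 0) where
  nonneg u v _ := sq_nonneg u
  deriv u v u' v' t hu _ := by
    refine (hu.fun_pow 2).congr_deriv ?_
    simp
  continuous₁ := by fun_prop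
  continuous₂ := by fun_prop
  monotone u₁ u₂ v₁ v₂ hv₁ hv₂ := by
    nlinarith [mul_nonneg (sub_nonneg.2 hv₁.2) (sq_nonneg (u₁ - u₂)),
      mul_nonneg (sub_nonneg.2 hv₂.2) (sq_nonneg (u₁ - u₂))]

/-- Tangent line inequality for `x ↦ x ^ a`, `a ≥ 1`. -/
lemma rpow_sub_rpow_le_of_one_le {a x y : ℝ} (ha : 1 ≤ a) (hx : 0 ≤ x) (hy : 0 ≤ y) :
    x ^ a - y ^ a ≤ a * x ^ (a - 1) * (x - y) := by
  rcases hx.eq_or_lt with rfl | hx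
  · rw [zero_rpow (by linarith)]
    rcases ha.eq_or_lt with rfl | ha
    · simp
    · rw [zero_rpow (by linarith)]
      simpa using rpow_nonneg hy a
  · have h := one_add_mul_self_le_rpow_one_add (s := y / x - 1)
      (by have := div_nonneg hy hx.le; linarith) ha
    rw [add_sub_cancel, div_rpow hy hx.le] at h
    have hxa : x ^ a = x ^ (a - 1) * x := by
      rw [← rpow_add_one hx.ne', sub_add_cancel]
    have hp : 0 < x ^ a := rpow_pos_of_pos hx a
    have h2 := mul_le_mul_of_nonneg_right h hp.le
    rw [div_mul_cancel₀ _ hp.ne'] at h2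
    have : (1 + a * (y / x - 1)) * x ^ a = x ^ a + a * x ^ (a - 1) * (y - x) := by
      rw [hxa]; field_simp
    linarith

/-- Tangent line inequality for `x ↦ x ^ r`, `0 ≤ r ≤ 1`. -/
lemma mul_rpow_le_rpow_sub_rpow {r x y : ℝ} (hr : 0 ≤ r) (hr1 : r ≤ 1) (hx : 0 < x) (hy : 0 ≤ y) :
    r * x ^ (r - 1) * (x - y) ≤ x ^ r - y ^ r := by
  have h := rpow_one_add_le_one_add_mul_self (s := y / x - 1)
      (by have := div_nonneg hy hx.le; linarith) hr hr1
  rw [add_sub_cancel, div_rpow hy hx.le] at h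
  have hxa : x ^ r = x ^ (r - 1) * x := by
    rw [← rpow_add_one hx.ne', sub_add_cancel]
  have hp : 0 < x ^ r := rpow_pos_of_pos hx r
  have h2 := mul_le_mul_of_nonneg_right h hp.le
  rw [div_mul_cancel₀ _ hp.ne'] at h2
  have : (1 + r * (y / x - 1)) * x ^ r = x ^ r + r * x ^ (r - 1) * (y - x) := by
    rw [hxa]; field_simp
  linarith

/-- The Bellman function for `2 < q ≤ 4`, with `p = q / 2` and `a (p - 1) = 1`. -/
lemma isBellman_rpow_add {p a : ℝ} (M : ℝ) (hp : 1 < p) (ha : 1 ≤ a) (hap : a * (p - 1) = 1) :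
    IsBellman 1 M (fun u v => (u ^ 2 + v ^ a) ^ p)
      (fun u v => p * (u ^ 2 + v ^ a) ^ (p - 1) * (2 * u))
      (fun u v => p * (u ^ 2 + v ^ a) ^ (p - 1) * (a * v ^ (a - 1))) where
  nonneg u v hv := by positivity
  deriv u v u' v' t hu hv := by
    have h1 := (hu.fun_pow 2).fun_add (hv.rpow_const (p := a) (Or.inr ha))
    refine (h1.rpow_const (p := p) (Or.inr hp.le)).congr_deriv ?_
    norm_num
    ring
  continuous₁ := by
    have h1 : Continuous fun x : ℝ => x ^ a := continuous_rpow_const (by linarith)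
    have h2 : Continuous fun x : ℝ => x ^ (p - 1) := continuous_rpow_const (by linarith)
    fun_prop
  continuous₂ := by
    have h1 : Continuous fun x : ℝ => x ^ a := continuous_rpow_const (by linarith)
    have h2 : Continuous fun x : ℝ => x ^ (p - 1) := continuous_rpow_const (by linarith)
    have h3 : Continuous fun x : ℝ => x ^ (a - 1) := continuous_rpow_const (by linarith)
    fun_prop
  monotone u u' v v' hv hv' := by
    have hle : ∀ u v : ℝ, 0 ≤ v → v ≤ (u ^ 2 + v ^ a) ^ (p - 1) := fun u v hv => by
      calc v = (v ^ a) ^ (p - 1) := by rw [← rpow_mul hv, hap, rpow_one]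
        _ ≤ _ := rpow_le_rpow (by positivity) (by nlinarith) (by linarith)
    have t1 := rpow_sub_rpow_le_of_one_le ha hv.1 hv'.1
    have t2 := rpow_sub_rpow_le_of_one_le ha hv'.1 hv.1
    have l1 := hle u v hv.1
    have l2 := hle u' v' hv'.1
    have mono : ∀ u v u' v' : ℝ, 0 ≤ v → 0 ≤ v' →
        0 ≤ ((u ^ 2 + v ^ a) ^ (p - 1) - (u' ^ 2 + v' ^ a) ^ (p - 1)) *
          ((u ^ 2 + v ^ a) - (u' ^ 2 + v' ^ a)) := fun u v u' v' hv hv' => by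
      rcases le_total (u ^ 2 + v ^ a) (u' ^ 2 + v' ^ a) with h | h
      · exact mul_nonneg_of_nonpos_of_nonpos
          (sub_nonpos.2 (rpow_le_rpow (by positivity) h (by linarith))) (sub_nonpos.2 h)
      · exact mul_nonneg
          (sub_nonneg.2 (rpow_le_rpow (by positivity) h (by linarith))) (sub_nonneg.2 h)
    have m1 := mono u v u' v' hv.1 hv'.1
    have hv0 := hv.1
    have hv0' := hv'.1
    have s0 : 0 ≤ (u ^ 2 + v ^ a) ^ (p - 1) := by positivity
    have s0' : 0 ≤ (u' ^ 2 + v' ^ a) ^ (p - 1) := by positivity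
    set σ := (u ^ 2 + v ^ a) ^ (p - 1)
    set σ' := (u' ^ 2 + v' ^ a) ^ (p - 1)
    set X := a * v ^ (a - 1)
    set X' := a * v' ^ (a - 1)
    set S := v ^ a
    set S' := v' ^ a
    have main : (σ + σ') * (u - u') ^ 2 ≤
        (σ * (2 * u) - σ' * (2 * u')) * (u - u') + (σ * X - σ' * X') * (v - v') := by
      rcases le_total σ σ' with h | h
      · nlinarith [mul_nonneg s0 (by linarith : 0 ≤ (X - X') * (v - v')),
          mul_nonneg (sub_nonneg.2 h) (by linarith : 0 ≤ X' * (v' - v) - (S' - S))]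
      · nlinarith [mul_nonneg s0' (by linarith : 0 ≤ (X - X') * (v - v')),
          mul_nonneg (sub_nonneg.2 h) (by linarith : 0 ≤ X * (v - v') - (S - S'))]
    have step : (v + v') * (u - u') ^ 2 ≤ (σ + σ') * (u - u') ^ 2 :=
      mul_le_mul_of_nonneg_right (add_le_add l1 l2) (sq_nonneg _)
    have pos : 0 ≤ (σ + σ') * (u - u') ^ 2 := by positivity
    calc 1 * ((v + v') * (u - u') ^ 2) ≤ p * ((σ + σ') * (u - u') ^ 2) := by nlinarith
      _ ≤ p * ((σ * (2 * u) - σ' * (2 * u')) * (u - u') + (σ * X - σ' * X') * (v - v')) := by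
        gcongr
      _ = _ := by ring

/-- The Bellman function for `q ≥ 4`, with `r = 2 / (q - 2)`. -/
lemma isBellman_add_rpow {q r : ℝ} (M : ℝ) (hq : 4 ≤ q) (hr : r * (q - 2) = 2) :
    IsBellman (1 / 2) M (fun u v => v * u ^ 2 + |u| ^ q + 8 / (r * (1 + r)) * v ^ (1 + r))
      (fun u v => 2 * u * v + q * |u| ^ (q - 2) * u)
      (fun u v => u ^ 2 + 8 / r * v ^ r) where
  nonneg u v hv := by
    have : 0 < r := by by_contra! h; nlinarith
    positivity
  deriv u v u' v' t hu hv := by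
    have hr0 : 0 < r := by by_contra! h; nlinarith
    have h1 := (hv.fun_mul (hu.fun_pow 2)).fun_add
      ((hasDerivAt_abs_rpow (u t) (p := q) (by linarith)).comp t hu)
    have h2 := (hv.rpow_const (p := 1 + r) (Or.inr (by linarith))).const_mul (8 / (r * (1 + r)))
    refine (h1.fun_add h2).congr_deriv ?_
    simp only [add_sub_cancel_left]
    field_simp
    norm_num
    ring
  continuous₁ := by
    have h1 : Continuous fun x : ℝ => x ^ (q - 2) := continuous_rpow_const (by linarith)
    fun_prop
  continuous₂ := by
    have hr0 : 0 < r := by by_contra! h; nlinarith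
    have h1 : Continuous fun x : ℝ => x ^ r := continuous_rpow_const hr0.le
    fun_prop
  monotone u u' v v' hv hv' := by
    have hr0 : 0 < r := by by_contra! h; nlinarith
    have hr1 : r ≤ 1 := by nlinarith
    wlog hvv : v' ≤ v generalizing u u' v v'
    · have := this u' u v' v hv' hv (le_of_not_ge hvv)
      linarith
    have hv0 := hv.1
    have hv0' := hv'.1
    have hu : (|u| ^ (q - 2) + |u'| ^ (q - 2)) * (u - u') ^ 2 / 2 ≤
        (|u| ^ (q - 2) * u - |u'| ^ (q - 2) * u') * (u - u') := by
      have : 0 ≤ (|u| ^ (q - 2) - |u'| ^ (q - 2)) * (u ^ 2 - u' ^ 2) := by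
        rcases le_total |u| |u'| with h | h
        · exact mul_nonneg_of_nonpos_of_nonpos
            (sub_nonpos.2 (rpow_le_rpow (abs_nonneg _) h (by linarith)))
            (sub_nonpos.2 (sq_le_sq.2 h))
        · exact mul_nonneg (sub_nonneg.2 (rpow_le_rpow (abs_nonneg _) h (by linarith)))
            (sub_nonneg.2 (sq_le_sq.2 h))
      linarith
    have hU : ∀ w : ℝ, 0 < v → w ^ 2 ≤ (v + |w| ^ (q - 2)) * v ^ (r - 1) := fun w hvp => by
      have hW : ∀ W, 0 ≤ W → v ≤ W → |w| ^ (q - 2) ≤ W → w ^ 2 ≤ W * v ^ (r - 1) :=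
          fun W h0 hvW hwW => by
        calc w ^ 2 = (|w| ^ (q - 2)) ^ r := by
              rw [← rpow_mul (abs_nonneg _), mul_comm, hr, rpow_two, sq_abs]
          _ ≤ W ^ r := rpow_le_rpow (by positivity) hwW hr0.le
          _ = W * W ^ (r - 1) := by
              rw [mul_comm, ← rpow_add_one (by linarith), sub_add_cancel]
          _ ≤ W * v ^ (r - 1) := by
              gcongr W * ?_
              exact rpow_le_rpow_of_nonpos hvp hvW (by linarith)
      have hw : 0 ≤ |w| ^ (q - 2) := by positivity
      exact hW _ (by linarith) (by linarith) (by linarith)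
    rcases hv0.eq_or_lt with h | hvp
    · have e : v' = 0 := le_antisymm (h ▸ hvv) hv0'
      subst e
      subst h
      have e1 : 0 ≤ |u| ^ (q - 2) := by positivity
      have e2 : 0 ≤ |u'| ^ (q - 2) := by positivity
      nlinarith [mul_nonneg (add_nonneg e1 e2) (sq_nonneg (u - u'))]
    have ht := mul_rpow_le_rpow_sub_rpow hr0.le hr1 hvp hv0'
    have hd : 0 ≤ v - v' := sub_nonneg.2 hvv
    have ht2 : 8 * v ^ (r - 1) * (v - v') ^ 2 ≤
        (8 / r * v ^ r - 8 / r * v' ^ r) * (v - v') := by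
      have := mul_le_mul_of_nonneg_left (mul_le_mul_of_nonneg_right ht hd)
        (by positivity : 0 ≤ 8 / r)
      calc _ = 8 / r * (r * v ^ (r - 1) * (v - v') * (v - v')) := by field_simp
        _ ≤ _ := this
        _ = _ := by ring
    have hY : 0 ≤ v ^ (r - 1) := by positivity
    have hP : 0 ≤ |u| ^ (q - 2) := by positivity
    have hP' : 0 ≤ |u'| ^ (q - 2) := by positivity
    have b1 := hU u hvp
    have b2 := hU u' hvp
    set P := |u| ^ (q - 2)
    set P' := |u'| ^ (q - 2)
    set Y := v ^ (r - 1)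
    have cross : ∀ w Q : ℝ, 0 ≤ Q → w ^ 2 ≤ (v + Q) * Y →
        -(2 * w * (u - u') * (v - v')) ≤ (v + Q) * (u - u') ^ 2 / 4 + 4 * Y * (v - v') ^ 2 := by
      intro w Q hQ hw
      have hA : 0 < v + Q := by linarith
      have h1 : 0 ≤ ((v + Q) * (u - u') + 4 * w * (v - v')) ^ 2 := sq_nonneg _
      have h2 := mul_le_mul_of_nonneg_right hw (sq_nonneg (v - v'))
      refine le_of_mul_le_mul_left ?_ hA
      nlinarith
    have c1 := cross u P hP b1
    have c2 := cross u' P' hP' b2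
    have hD : 0 ≤ P * (u - u') ^ 2 := by positivity
    have hD' : 0 ≤ P' * (u - u') ^ 2 := by positivity
    have hvd : v' * (u - u') ^ 2 ≤ v * (u - u') ^ 2 :=
      mul_le_mul_of_nonneg_right hvv (sq_nonneg _)
    have hvd' : 0 ≤ v' * (u - u') ^ 2 := by positivity
    have hq2 : 4 * ((P + P') * (u - u') ^ 2 / 2) ≤
        q * ((P * u - P' * u') * (u - u')) := by
      have : 0 ≤ (P + P') * (u - u') ^ 2 / 2 := by positivity
      nlinarith
    nlinarith

/-! ### The Dirichlet form -/

lemma hasSum_dirichlet {s : ℝ} (hs : s ∈ Set.Ioo (0 : ℝ) 1) {b : ℤ → ℝ} {C : ℝ}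
    (hb : ∀ x, |b x| ≤ C) (G : EllOne) :
    HasSum (fun p : ℤ × ℤ => (b p.1 - b p.2) * (G p.1 - G p.2) * Ker s (p.1 - p.2))
      (2 * ∑' x, b x * (lapOp hs G : EllOne) x) := by
  have h12 := summable_bdd_mul_Ker hs (EllOne.summable_abs G) (b := fun p => b p.1)
    fun p => hb p.1
  have h22 := summable_bdd_mul_Ker hs (EllOne.summable_abs G) (b := fun p => b p.2)
    fun p => hb p.2
  have h21 := (Equiv.prodComm ℤ ℤ).hasSum_iff.2 h12.hasSum
  have h11 := (Equiv.prodComm ℤ ℤ).hasSum_iff.2 h22.hasSum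
  have hLG : ∑' x, b x * (lapOp hs G : EllOne) x =
      (∑' p : ℤ × ℤ, b p.2 * (Ker s (p.1 - p.2) * G p.2)) -
        ∑' p : ℤ × ℤ, b p.1 * (Ker s (p.1 - p.2) * G p.2) := by
    have h := h11.sub h12.hasSum
    rw [← h.tsum_eq, h.summable.tsum_prod]
    refine tsum_congr fun x => ?_
    rw [coe_lapOp, Lop, ← tsum_mul_left]
    refine tsum_congr fun y => ?_
    simp only [Function.comp_apply, Equiv.prodComm_apply, Prod.fst_swap, Prod.snd_swap]
    rw [Ker_sub_comm s y x]
    ring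
  have h := (h11.sub h12.hasSum).add (h22.hasSum.sub h21)
  have e : 2 * ∑' x, b x * (lapOp hs G : EllOne) x =
      (∑' p : ℤ × ℤ, b p.2 * (Ker s (p.1 - p.2) * G p.2) -
        ∑' p : ℤ × ℤ, b p.1 * (Ker s (p.1 - p.2) * G p.2)) +
      (∑' p : ℤ × ℤ, b p.2 * (Ker s (p.1 - p.2) * G p.2) -
        ∑' p : ℤ × ℤ, b p.1 * (Ker s (p.1 - p.2) * G p.2)) := by
    rw [hLG]; ring
  rw [e]
  refine h.congr_fun fun p => ?_
  simp only [Function.comp_apply, Equiv.prodComm_apply, Prod.fst_swap, Prod.snd_swap]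
  rw [Ker_sub_comm s p.2 p.1]
  ring

lemma tsum_mul_lapOp_comm {s : ℝ} (hs : s ∈ Set.Ioo (0 : ℝ) 1) (F G : EllOne) :
    ∑' x, F x * (lapOp hs G : EllOne) x = ∑' x, (lapOp hs F : EllOne) x * G x := by
  have h1 := hasSum_dirichlet hs (EllOne.abs_apply_le F) G
  have h2 := hasSum_dirichlet hs (EllOne.abs_apply_le G) F
  have h : (2 : ℝ) * ∑' x, F x * (lapOp hs G : EllOne) x =
      2 * ∑' x, G x * (lapOp hs F : EllOne) x :=
    h1.unique (h2.congr_fun fun p => by ring)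
  simp only [mul_comm (G _)] at h
  linarith

lemma tsum_mul_lapOp_pow_comm {s : ℝ} (hs : s ∈ Set.Ioo (0 : ℝ) 1) (F G : EllOne) (n : ℕ) :
    ∑' x, F x * ((lapOp hs ^ n) G : EllOne) x = ∑' x, ((lapOp hs ^ n) F : EllOne) x * G x := by
  induction n generalizing F with
  | zero => rfl
  | succ n ih =>
    rw [pow_succ', mul_apply_eq_comp, tsum_mul_lapOp_comm, ih, ← pow_succ', pow_succ,
      mul_apply_eq_comp]

/-- The indicator of `{z}` in `ℓ¹(ℤ)`. -/
noncomputable def dirac (z : ℤ) : EllOne := lp.single 1 z (1 : ℝ)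

lemma dirac_apply (z x : ℤ) : dirac z x = if x = z then 1 else 0 := by
  simp [dirac, Pi.single_apply]

lemma lapOp_pow_dirac_comm {s : ℝ} (hs : s ∈ Set.Ioo (0 : ℝ) 1) (n : ℕ) (x z : ℤ) :
    ((lapOp hs ^ n) (dirac z) : EllOne) x = ((lapOp hs ^ n) (dirac x) : EllOne) z := by
  simpa [dirac_apply] using tsum_mul_lapOp_pow_comm hs (dirac x) (dirac z) n

lemma hker_eq {s : ℝ} (hs : s ∈ Set.Ioo (0 : ℝ) 1) (t : ℝ) (x z : ℤ) :
    hker s t x z = (heatOp hs t (dirac x) : EllOne) z := by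
  have h : (fun y => if y = z then (1 : ℝ) else 0) = dirac z := by
    ext y; rw [dirac_apply]
  rw [hker, h, heat_eq hs, ← (hasSum_heatOp hs t (dirac z) x).tsum_eq,
    ← (hasSum_heatOp hs t (dirac x) z).tsum_eq]
  simp only [lapOp_pow_dirac_comm hs _ x z]

/-- The integrand of `G_*(f)²`. -/
noncomputable def gStarDensity (s : ℝ) (f : ℤ → ℝ) (x : ℤ) (t : ℝ) : ℝ :=
  ∑' p : ℤ × ℤ, (heat s t f (p.2 + p.1) - heat s t f p.2) ^ 2 * hker s t x p.2 * Ker s p.1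

lemma gStarDensity_nonneg {s : ℝ} (hs : s ∈ Set.Ioo (0 : ℝ) 1) (f : ℤ → ℝ) (x : ℤ) {t : ℝ}
    (ht : 0 ≤ t) : 0 ≤ gStarDensity s f x t := by
  refine tsum_nonneg fun p => mul_nonneg (mul_nonneg (sq_nonneg _) ?_) (Ker_nonneg hs _)
  rw [hker_eq hs]
  refine heatOp_nonneg hs ht (fun y => ?_) _
  rw [dirac_apply]
  split_ifs <;> simp

lemma abs_sub_sq_le (U : EllOne) (x y : ℤ) : |(U x - U y) ^ 2| ≤ (2 * ‖U‖) ^ 2 := by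
  rw [abs_pow]
  have h1 := EllOne.abs_apply_le U x
  have h2 := EllOne.abs_apply_le U y
  have h3 := abs_sub (U x) (U y)
  gcongr
  linarith

lemma summable_energy {s : ℝ} (hs : s ∈ Set.Ioo (0 : ℝ) 1) (U V : EllOne) :
    Summable fun p : ℤ × ℤ => (U (p.2 + p.1) - U p.2) ^ 2 * V p.2 * Ker s p.1 := by
  rw [← subLeftEquiv.summable_iff]
  refine (summable_bdd_mul_Ker hs (EllOne.summable_abs V)
    (b := fun p => (U p.1 - U p.2) ^ 2) fun p => abs_sub_sq_le U _ _).congr fun p => ?_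
  simp only [subLeftEquiv, Function.comp_apply, Equiv.coe_fn_mk, add_sub_cancel]
  ring

lemma hasSum_energy {s : ℝ} (hs : s ∈ Set.Ioo (0 : ℝ) 1) (U V : EllOne) :
    HasSum (fun p : ℤ × ℤ => (V p.1 + V p.2) * (U p.1 - U p.2) ^ 2 * Ker s (p.1 - p.2))
      (2 * ∑' p : ℤ × ℤ, (U (p.2 + p.1) - U p.2) ^ 2 * V p.2 * Ker s p.1) := by
  have h1 := subLeftEquiv.hasSum_iff.2 (summable_energy hs U V).hasSum
  have h2 := (Equiv.prodComm ℤ ℤ).hasSum_iff.2 h1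
  convert h1.add h2 using 1
  · ext p
    simp only [subLeftEquiv, Function.comp_apply, Equiv.coe_fn_mk, add_sub_cancel,
      Equiv.prodComm_apply, Prod.fst_swap, Prod.snd_swap]
    rw [Ker_sub_comm s p.2 p.1]
    ring
  · ring

/-- A finitely supported function as an element of `ℓ¹(ℤ)`. -/
noncomputable def ofFinset (S : Finset ℤ) (h : ℤ → ℝ) : EllOne := ∑ x ∈ S, h x • dirac x

lemma ofFinset_apply (S : Finset ℤ) (h : ℤ → ℝ) (y : ℤ) :
    ofFinset S h y = if y ∈ S then h y else 0 := by
  simp only [ofFinset, lp.coeFn_sum, Finset.sum_apply, lp.coeFn_smul, Pi.smul_apply, smul_eq_mul,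
    dirac_apply]
  simp

lemma sum_mul_gStarDensity {s : ℝ} (hs : s ∈ Set.Ioo (0 : ℝ) 1) (F : EllOne) (S : Finset ℤ)
    (h : ℤ → ℝ) (t : ℝ) :
    ∑ x ∈ S, h x * gStarDensity s F x t =
      ∑' p : ℤ × ℤ, ((heatOp hs t F : EllOne) (p.2 + p.1) - (heatOp hs t F : EllOne) p.2) ^ 2 *
        (heatOp hs t (ofFinset S h) : EllOne) p.2 * Ker s p.1 := by
  simp only [gStarDensity, heat_eq hs, hker_eq hs, ← tsum_mul_left]
  rw [← Summable.tsum_finsetSum fun x _ => (summable_energy hs _ _).mul_left _]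
  refine tsum_congr fun p => ?_
  rw [ofFinset, map_sum]
  simp only [map_smul, lp.coeFn_sum, Finset.sum_apply, lp.coeFn_smul, Pi.smul_apply, smul_eq_mul]
  rw [Finset.mul_sum, Finset.sum_mul]
  exact Finset.sum_congr rfl fun x _ => by ring

/-! ### The Bellman function method -/

lemma IsBellman.energy_le {c M : ℝ} {B B₁ B₂ : ℝ → ℝ → ℝ} (hB : IsBellman c M B B₁ B₂) {s : ℝ}
    (hs : s ∈ Set.Ioo (0 : ℝ) 1) {U V : EllOne} (hV : ∀ x, V x ∈ Set.Icc 0 M) {C : ℝ}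
    (hC₁ : ∀ x, |B₁ (U x) (V x)| ≤ C) (hC₂ : ∀ x, |B₂ (U x) (V x)| ≤ C) :
    c * ∑' p : ℤ × ℤ, (U (p.2 + p.1) - U p.2) ^ 2 * V p.2 * Ker s p.1 ≤
      ∑' x, (B₁ (U x) (V x) * (lapOp hs U : EllOne) x +
        B₂ (U x) (V x) * (lapOp hs V : EllOne) x) := by
  have hsum : ∀ {b : ℤ → ℝ} (G : EllOne), (∀ x, |b x| ≤ C) → Summable fun x => b x * G x :=
    fun G hb => Summable.of_norm_bounded ((EllOne.summable_abs G).mul_left C) fun x => by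
      rw [norm_mul]
      exact mul_le_mul_of_nonneg_right (hb x) (abs_nonneg _)
  rw [(hsum _ hC₁).tsum_add (hsum _ hC₂)]
  have h := hasSum_le (fun p => ?_) ((hasSum_energy hs U V).mul_left c)
    ((hasSum_dirichlet hs hC₁ U).add (hasSum_dirichlet hs hC₂ V))
  · linarith
  · have := mul_le_mul_of_nonneg_right (hB.monotone (U p.1) (U p.2) _ _ (hV p.1) (hV p.2))
      (Ker_nonneg hs (p.1 - p.2))
    linarith

lemma IsBellman.exists_bound {c M : ℝ} {B B₁ B₂ : ℝ → ℝ → ℝ} (hB : IsBellman c M B B₁ B₂)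
    (ρ : ℝ) : ∃ C, ∀ u v, |u| ≤ ρ → |v| ≤ ρ → |B₁ u v| ≤ C ∧ |B₂ u v| ≤ C := by
  have hK : IsCompact (Set.Icc (-ρ) ρ ×ˢ Set.Icc (-ρ) ρ) := isCompact_Icc.prod isCompact_Icc
  obtain ⟨C₁, h₁⟩ := hK.exists_bound_of_continuousOn hB.continuous₁.continuousOn
  obtain ⟨C₂, h₂⟩ := hK.exists_bound_of_continuousOn hB.continuous₂.continuousOn
  refine ⟨max C₁ C₂, fun u v hu hv => ⟨?_, ?_⟩⟩
  · exact (h₁ (u, v) ⟨abs_le.1 hu, abs_le.1 hv⟩).trans (le_max_left _ _)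
  · exact (h₂ (u, v) ⟨abs_le.1 hu, abs_le.1 hv⟩).trans (le_max_right _ _)

/-- The total Bellman energy is differentiable along the heat flow, and it dissipates at least
`c` times the weighted energy. -/
lemma IsBellman.exists_hasDerivAt {c M : ℝ} {B B₁ B₂ : ℝ → ℝ → ℝ} (hB : IsBellman c M B B₁ B₂)
    {s : ℝ} (hs : s ∈ Set.Ioo (0 : ℝ) 1) (F H : EllOne) (hH : ∀ x, H x ∈ Set.Icc 0 M)
    (hsum : Summable fun x => B (F x) (H x)) {R t : ℝ} (ht : t ∈ Set.Ioo (-R) R) :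
    ∃ D, HasDerivAt
        (fun t => ∑' x, B ((heatOp hs t F : EllOne) x) ((heatOp hs t H : EllOne) x)) (-D) t ∧
      (0 ≤ t → c * ∑' p : ℤ × ℤ,
        ((heatOp hs t F : EllOne) (p.2 + p.1) - (heatOp hs t F : EllOne) p.2) ^ 2 *
          (heatOp hs t H : EllOne) p.2 * Ker s p.1 ≤ D) := by
  obtain ⟨m₁, hm₁, hb₁⟩ := exists_heatOp_majorant hs F R
  obtain ⟨m₂, hm₂, hb₂⟩ := exists_heatOp_majorant hs H R
  obtain ⟨n₁, hn₁, hd₁⟩ := exists_heatOp_majorant hs (lapOp hs F) R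
  obtain ⟨n₂, hn₂, hd₂⟩ := exists_heatOp_majorant hs (lapOp hs H) R
  have habs : ∀ {τ}, τ ∈ Set.Ioo (-R) R → |τ| ≤ R := fun hτ => (abs_lt.2 hτ).le
  have hm₁0 : ∀ x, 0 ≤ m₁ x := fun x => (abs_nonneg _).trans (hb₁ t (habs ht) x)
  have hm₂0 : ∀ x, 0 ≤ m₂ x := fun x => (abs_nonneg _).trans (hb₂ t (habs ht) x)
  obtain ⟨C, hC⟩ := hB.exists_bound (max (∑' x, m₁ x) (∑' x, m₂ x))
  have hCτ : ∀ τ ∈ Set.Ioo (-R) R, ∀ x,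
      |B₁ ((heatOp hs τ F : EllOne) x) ((heatOp hs τ H : EllOne) x)| ≤ C ∧
      |B₂ ((heatOp hs τ F : EllOne) x) ((heatOp hs τ H : EllOne) x)| ≤ C := fun τ hτ x =>
    hC _ _ (((hb₁ τ (habs hτ) x).trans (hm₁.le_tsum x fun y _ => hm₁0 y)).trans (le_max_left _ _))
      (((hb₂ τ (habs hτ) x).trans (hm₂.le_tsum x fun y _ => hm₂0 y)).trans (le_max_right _ _))
  have hR : 0 < R := by linarith [ht.1, ht.2]
  have hder := hasDerivAt_tsum_of_isPreconnected (𝕜 := ℝ) (t := Set.Ioo (-R) R) (y₀ := 0) (y := t)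
    (u := fun x => C * n₁ x + C * n₂ x)
    (g := fun x τ => B ((heatOp hs τ F : EllOne) x) ((heatOp hs τ H : EllOne) x))
    (g' := fun x τ => B₁ ((heatOp hs τ F : EllOne) x) ((heatOp hs τ H : EllOne) x) *
        (-(lapOp hs (heatOp hs τ F) : EllOne) x) +
      B₂ ((heatOp hs τ F : EllOne) x) ((heatOp hs τ H : EllOne) x) *
        (-(lapOp hs (heatOp hs τ H) : EllOne) x))
    ((hn₁.mul_left C).add (hn₂.mul_left C)) isOpen_Ioo isPreconnected_Ioo
    (fun x τ _ => hB.deriv _ _ _ _ _ (hasDerivAt_heatOp hs F x τ) (hasDerivAt_heatOp hs H x τ))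
    (fun x τ hτ => by
      have h₁ := hd₁ τ (habs hτ) x
      have h₂ := hd₂ τ (habs hτ) x
      rw [← lapOp_heatOp_comm] at h₁ h₂
      obtain ⟨hC₁, hC₂⟩ := hCτ τ hτ x
      have hC0 := (abs_nonneg _).trans hC₁
      refine (norm_add_le _ _).trans (add_le_add ?_ ?_)
      · rw [norm_mul, norm_neg]
        exact mul_le_mul hC₁ h₁ (abs_nonneg _) hC0
      · rw [norm_mul, norm_neg]
        exact mul_le_mul hC₂ h₂ (abs_nonneg _) hC0)
    ⟨by linarith, hR⟩ (by simpa only [heatOp_zero] using hsum) ht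
  refine ⟨_, hder.congr_deriv ?_, fun ht0 => hB.energy_le hs
    (fun x => ⟨heatOp_nonneg hs ht0 (fun y => (hH y).1) x, heatOp_le hs ht0 (fun y => (hH y).2) x⟩)
    (fun x => (hCτ t ht x).1) (fun x => (hCτ t ht x).2)⟩
  rw [← tsum_neg]
  exact tsum_congr fun x => by ring

/-- The bilinear estimate obtained from a Bellman function. -/
lemma IsBellman.sum_mul_integral_le {c M : ℝ} {B B₁ B₂ : ℝ → ℝ → ℝ} (hB : IsBellman c M B B₁ B₂)
    {s : ℝ} (hs : s ∈ Set.Ioo (0 : ℝ) 1) (F : EllOne) (S : Finset ℤ) {h : ℤ → ℝ}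
    (hh : ∀ x ∈ S, h x ∈ Set.Icc 0 M) (hM : 0 ≤ M)
    (hsum : Summable fun x => B (F x) (if x ∈ S then h x else 0))
    (hint : ∀ x ∈ S, IntegrableOn (gStarDensity s F x) (Set.Ioi 0)) :
    c * ∑ x ∈ S, h x * ∫ t in Set.Ioi (0 : ℝ), gStarDensity s F x t ≤
      ∑' x, B (F x) (if x ∈ S then h x else 0) := by
  have hH : ∀ x, ofFinset S h x ∈ Set.Icc 0 M := fun x => by
    rw [ofFinset_apply]
    split_ifs with hx
    exacts [hh x hx, ⟨le_rfl, hM⟩]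
  have hsum' : Summable fun x => B (F x) (ofFinset S h x) := by
    simpa only [ofFinset_apply] using hsum
  set φ : ℝ → ℝ := fun t => c * ∑ x ∈ S, h x * gStarDensity s F x t with hφ
  have hφint : IntegrableOn φ (Set.Ioi 0) :=
    (integrable_finsetSum S fun x hx => (hint x hx).const_mul (h x)).const_mul c
  have hφeq : ∫ t in Set.Ioi (0 : ℝ), φ t =
      c * ∑ x ∈ S, h x * ∫ t in Set.Ioi (0 : ℝ), gStarDensity s F x t := by
    rw [hφ, integral_const_mul, integral_finsetSum S fun x hx => (hint x hx).const_mul (h x)]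
    simp only [integral_const_mul]
  rw [← hφeq]
  refine le_of_tendsto (intervalIntegral_tendsto_integral_Ioi 0 hφint Filter.tendsto_id) ?_
  filter_upwards [Filter.eventually_ge_atTop 0] with T hT
  set Φ : ℝ → ℝ := fun t =>
    ∑' x, B ((heatOp hs t F : EllOne) x) ((heatOp hs t (ofFinset S h) : EllOne) x) with hΦ
  have hex := fun t (ht : t ∈ Set.Icc 0 T) =>
    hB.exists_hasDerivAt hs F (ofFinset S h) hH hsum' (R := T + 1) (t := t)
      ⟨by linarith [ht.1], by linarith [ht.2]⟩
  choose! D hD hDle using hex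
  have key := intervalIntegral.integral_le_sub_of_hasDeriv_right_of_le (g := fun t => -Φ t)
    (g' := D) (φ := φ) hT
    (fun t ht => (hD t ht).continuousAt.neg.continuousWithinAt)
    (fun t ht => by
      have := (hD t (Set.Ioo_subset_Icc_self ht)).fun_neg.hasDerivWithinAt (s := Set.Ioi t)
      rwa [neg_neg] at this)
    ((integrableOn_Icc_iff_integrableOn_Ioc).2 (hφint.mono_set fun t ht => ht.1))
    (fun t ht => by
      simp only [hφ]
      rw [sum_mul_gStarDensity hs]
      exact hDle t (Set.Ioo_subset_Icc_self ht) ht.1.le)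
  have hΦT : 0 ≤ Φ T := tsum_nonneg fun x =>
    hB.nonneg _ _ (heatOp_nonneg hs hT (fun y => (hH y).1) x)
  have hΦ0 : Φ 0 = ∑' x, B (F x) (if x ∈ S then h x else 0) := by
    simp only [hΦ, heatOp_zero, ofFinset_apply]
  simp only [id] at *
  linarith

/-! ### The `ℓ^q` estimate -/

lemma add_rpow_le_two_rpow_mul {x y p : ℝ} (hx : 0 ≤ x) (hy : 0 ≤ y) (hp : 0 ≤ p) :
    (x + y) ^ p ≤ 2 ^ p * (x ^ p + y ^ p) := by
  have hxp := rpow_nonneg hx p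
  have hyp := rpow_nonneg hy p
  have h2 : (0 : ℝ) ≤ 2 ^ p := by positivity
  rcases le_total x y with h | h
  · calc (x + y) ^ p ≤ (2 * y) ^ p := by gcongr; linarith
      _ = 2 ^ p * y ^ p := mul_rpow zero_le_two hy
      _ ≤ _ := by gcongr; linarith
  · calc (x + y) ^ p ≤ (2 * x) ^ p := by gcongr; linarith
      _ = 2 ^ p * x ^ p := mul_rpow zero_le_two hx
      _ ≤ _ := by gcongr; linarith

lemma mul_sq_le_rpow_add_rpow {u v q : ℝ} (hq : 2 < q) (hv : 0 ≤ v) :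
    v * u ^ 2 ≤ |u| ^ q + v ^ (q / (q - 2)) := by
  have hq2 : 0 < q - 2 := by linarith
  have hpq : (q / (q - 2)).HolderConjugate (q / 2) := by
    rw [holderConjugate_iff]
    refine ⟨by rw [lt_div_iff₀ hq2]; linarith, ?_⟩
    field_simp
    ring
  have h := young_inequality_of_nonneg hv (sq_nonneg u) hpq
  have e : (u ^ 2) ^ (q / 2) = |u| ^ q := by
    rw [← sq_abs, ← rpow_natCast, ← rpow_mul (abs_nonneg u)]
    congr 1
    push_cast
    field_simp
  rw [e] at h
  have h1 := div_le_self (rpow_nonneg hv (q / (q - 2))) hpq.lt.le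
  have h2 := div_le_self (rpow_nonneg (abs_nonneg u) q) hpq.symm.lt.le
  linarith

lemma exists_isBellman {q : ℝ} (hq : 2 < q) :
    ∃ c C : ℝ, 0 < c ∧ 0 < C ∧ ∀ M, ∃ B B₁ B₂ : ℝ → ℝ → ℝ, IsBellman c M B B₁ B₂ ∧
      ∀ u v, 0 ≤ v → B u v ≤ C * (|u| ^ q + v ^ (q / (q - 2))) := by
  have hq2 : 0 < q - 2 := by linarith
  rcases le_total q 4 with h4 | h4
  · refine ⟨1, 2 ^ (q / 2), one_pos, by positivity, fun M => ⟨_, _, _,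
      isBellman_rpow_add (p := q / 2) (a := 2 / (q - 2)) M (by linarith)
        (by rw [le_div_iff₀ hq2]; linarith) (by field_simp), fun u v hv => ?_⟩⟩
    refine (add_rpow_le_two_rpow_mul (sq_nonneg u) (by positivity) (by linarith)).trans_eq ?_
    have e₁ : ((2 : ℕ) : ℝ) * (q / 2) = q := by push_cast; field_simp
    have e₂ : 2 / (q - 2) * (q / 2) = q / (q - 2) := by field_simp
    rw [← sq_abs, ← rpow_natCast, ← rpow_mul (abs_nonneg u), ← rpow_mul hv, e₁, e₂]
  · have hr : 0 < 2 / (q - 2) := by positivity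
    have e : q / (q - 2) = 1 + 2 / (q - 2) := by field_simp; ring
    rw [e]
    set r := 2 / (q - 2) with hrdef
    refine ⟨1 / 2, 2 + 8 / (r * (1 + r)), by norm_num, by positivity, fun M => ⟨_, _, _,
      isBellman_add_rpow (q := q) (r := r) M h4 (by rw [hrdef]; field_simp), fun u v hv => ?_⟩⟩
    have h := mul_sq_le_rpow_add_rpow (u := u) hq hv
    rw [e] at h
    have hu := rpow_nonneg (abs_nonneg u) q
    have hv' := rpow_nonneg hv (1 + r)
    have hk : 0 < 8 / (r * (1 + r)) := by positivity
    nlinarith [mul_nonneg hk.le hu]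

lemma EllOne.summable_abs_rpow (F : EllOne) {q : ℝ} (hq : 1 ≤ q) :
    Summable fun x => |F x| ^ q := by
  refine Summable.of_nonneg_of_le (fun x => by positivity) (fun x => ?_)
    ((EllOne.summable_abs F).mul_left (‖F‖ ^ (q - 1)))
  calc |F x| ^ q = |F x| ^ (q - 1) * |F x| := by
        rcases (abs_nonneg (F x)).eq_or_lt with h | h
        · rw [← h, zero_rpow (by linarith), mul_zero]
        · rw [← rpow_add_one h.ne', sub_add_cancel]
    _ ≤ ‖F‖ ^ (q - 1) * |F x| :=
        mul_le_mul_of_nonneg_right (rpow_le_rpow (abs_nonneg _) (EllOne.abs_apply_le F x)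
          (by linarith)) (abs_nonneg _)

/-- The duality estimate behind the `ℓ^q` bound: a bound for the pairing of `G_*(F)²` with a
finitely supported weight. -/
lemma exists_sum_mul_integral_gStarDensity_le {q : ℝ} (hq : 2 < q) :
    ∃ C : ℝ, 0 < C ∧ ∀ s ∈ Set.Ioo (0 : ℝ) 1, ∀ (F : EllOne) (S : Finset ℤ) (h : ℤ → ℝ),
      (∀ x ∈ S, 0 ≤ h x) → (∀ x ∈ S, IntegrableOn (gStarDensity s F x) (Set.Ioi 0)) →
      ∑ x ∈ S, h x * ∫ t in Set.Ioi (0 : ℝ), gStarDensity s F x t ≤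
        C * (∑' x, |F x| ^ q + ∑ x ∈ S, h x ^ (q / (q - 2))) := by
  have hq2 : 0 < q - 2 := by linarith
  obtain ⟨c, C, hc, hC, hB⟩ := exists_isBellman hq
  refine ⟨C / c, by positivity, fun s hs F S h hh hint => ?_⟩
  obtain ⟨B, B₁, B₂, hB, hle⟩ := hB (∑ x ∈ S, h x)
  have hp : q / (q - 2) ≠ 0 := by positivity
  have h0 : ∀ x, 0 ≤ if x ∈ S then h x else 0 := fun x => by
    split_ifs with hx
    exacts [hh x hx, le_rfl]
  have hfin : HasSum (fun x => (if x ∈ S then h x else 0) ^ (q / (q - 2)))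
      (∑ x ∈ S, h x ^ (q / (q - 2))) := by
    have := hasSum_sum_of_ne_finset_zero (L := .unconditional ℤ) (s := S)
      (f := fun x => (if x ∈ S then h x else 0) ^ (q / (q - 2)))
      fun x hx => by rw [if_neg hx, zero_rpow hp]
    rwa [Finset.sum_congr rfl fun x hx => by rw [if_pos hx]] at this
  have hmaj := ((EllOne.summable_abs_rpow F (q := q) (by linarith)).hasSum.add hfin).mul_left C
  have hsum : Summable fun x => B (F x) (if x ∈ S then h x else 0) :=
    Summable.of_nonneg_of_le (fun x => hB.nonneg _ _ (h0 x)) (fun x => hle _ _ (h0 x))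
      hmaj.summable
  have key := hB.sum_mul_integral_le hs F S
    (fun x hx => ⟨hh x hx, Finset.single_le_sum hh hx⟩) (Finset.sum_nonneg hh) hsum hint
  have := key.trans (hasSum_le (fun x => hle _ _ (h0 x)) hsum.hasSum hmaj)
  rw [div_mul_eq_mul_div, le_div_iff₀ hc]
  linarith

lemma sum_integral_gStarDensity_le {s : ℝ} (hs : s ∈ Set.Ioo (0 : ℝ) 1) (F : EllOne)
    (S : Finset ℤ) (hint : ∀ x ∈ S, IntegrableOn (gStarDensity s F x) (Set.Ioi 0)) :
    ∑ x ∈ S, ∫ t in Set.Ioi (0 : ℝ), gStarDensity s F x t ≤ ∑' x, |F x| ^ (2 : ℝ) := by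
  have e : ∀ x, |F x| ^ (2 : ℝ) = F x ^ 2 := fun x => by rw [rpow_two, sq_abs]
  have hsum := EllOne.summable_abs_rpow F one_le_two
  simp only [e] at hsum ⊢
  simpa using isBellman_sq.sum_mul_integral_le hs F S (h := fun _ => 1)
    (fun x _ => ⟨zero_le_one, le_rfl⟩) zero_le_one hsum hint

lemma exists_sum_sqrt_integral_rpow_le {q : ℝ} (hq : 2 ≤ q) :
    ∃ C : ℝ, 0 < C ∧ ∀ s ∈ Set.Ioo (0 : ℝ) 1, ∀ (F : EllOne) (S : Finset ℤ),
      (∀ x ∈ S, IntegrableOn (gStarDensity s F x) (Set.Ioi 0)) →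
      ∑ x ∈ S, √(∫ t in Set.Ioi (0 : ℝ), gStarDensity s F x t) ^ q ≤ C * ∑' x, |F x| ^ q := by
  have hJ : ∀ s ∈ Set.Ioo (0 : ℝ) 1, ∀ (F : EllOne) (x : ℤ),
      √(∫ t in Set.Ioi (0 : ℝ), gStarDensity s F x t) ^ (2 : ℝ) =
        ∫ t in Set.Ioi (0 : ℝ), gStarDensity s F x t := fun s hs F x => by
    rw [rpow_two, sq_sqrt]
    exact setIntegral_nonneg measurableSet_Ioi fun t ht => gStarDensity_nonneg hs F x ht.le
  rcases hq.eq_or_lt with rfl | hq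
  · refine ⟨1, one_pos, fun s hs F S hint => ?_⟩
    simp only [hJ s hs F, one_mul]
    exact sum_integral_gStarDensity_le hs F S hint
  · have hq2 : 0 < q - 2 := by linarith
    obtain ⟨C, hC, hpair⟩ := exists_sum_mul_integral_gStarDensity_le hq
    set w : ℝ := (2 * C) ^ (-((q - 2) / 2)) with hw
    have hw0 : 0 < w := by positivity
    have hwp : 2 * C * w ^ (q / (q - 2)) = w := by
      have h1 : w ^ (q / (q - 2)) = (2 * C) ^ (-((q - 2) / 2) - 1) := by
        rw [hw, ← rpow_mul (by positivity)]
        congr 1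
        field_simp
        ring
      rw [h1, rpow_sub_one (by positivity), ← hw]
      field_simp
    refine ⟨2 * C / w, by positivity, fun s hs F S hint => ?_⟩
    set g : ℤ → ℝ := fun x => √(∫ t in Set.Ioi (0 : ℝ), gStarDensity s F x t) with hg
    have hg0 : ∀ x, 0 ≤ g x := fun x => sqrt_nonneg _
    have h := hpair s hs F S (fun x => w * g x ^ (q - 2))
      (fun x _ => mul_nonneg hw0.le (rpow_nonneg (hg0 x) _)) hint
    have h1 : ∀ x, w * g x ^ (q - 2) * ∫ t in Set.Ioi (0 : ℝ), gStarDensity s F x t =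
        w * g x ^ q := fun x => by
      rw [← hJ s hs F x, mul_assoc, ← rpow_add_of_nonneg (hg0 x) hq2.le zero_le_two,
        sub_add_cancel]
    have h2 : ∀ x, (w * g x ^ (q - 2)) ^ (q / (q - 2)) = w ^ (q / (q - 2)) * g x ^ q :=
      fun x => by
        rw [mul_rpow hw0.le (rpow_nonneg (hg0 x) _), ← rpow_mul (hg0 x),
          mul_div_cancel₀ _ hq2.ne']
    simp only [h1, h2, ← Finset.mul_sum] at h
    rw [div_mul_eq_mul_div, le_div_iff₀ hw0]
    nlinarith [congrArg (· * ∑ x ∈ S, g x ^ q) hwp]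

/-- For every `q ∈ [2,∞)` there is `c_q > 0`, depending only on `q`, such that for every
`s ∈ (0,1)` and every summable `f`, `‖G_* f‖_q ≤ c_q ‖f‖_q`. -/
theorem lq_bound_Gstar (q : ℝ) (hq : 2 ≤ q) :
    ∃ c : ℝ, 0 < c ∧ ∀ s : ℝ, s ∈ Set.Ioo (0 : ℝ) 1 → ∀ f : ℤ → ℝ, Summable f →
      lqNorm q (fun x => Real.sqrt (∫ t in Set.Ioi (0 : ℝ),
        ∑' p : ℤ × ℤ,
          (heat s t f (p.2 + p.1) - heat s t f p.2) ^ 2 * hker s t x p.2 * Ker s p.1)) ≤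
        c * lqNorm q f := by
  obtain ⟨C, hC, hbound⟩ := exists_sum_sqrt_integral_rpow_le hq
  refine ⟨C ^ (1 / q), by positivity, fun s hs f hf => ?_⟩
  set F : EllOne := ⟨f, memℓp_one_iff.2 hf.abs⟩
  change (∑' x, |√(∫ t in Set.Ioi (0 : ℝ), gStarDensity s F x t)| ^ q) ^ (1 / q) ≤
    C ^ (1 / q) * (∑' x, |F x| ^ q) ^ (1 / q)
  have hf0 : 0 ≤ ∑' x, |F x| ^ q := tsum_nonneg fun x => by positivity
  rw [← mul_rpow hC.le hf0]
  refine rpow_le_rpow (tsum_nonneg fun x => by positivity) ?_ (by positivity)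
  refine Real.tsum_le_of_sum_le (fun x => by positivity) fun T => ?_
  classical
  refine le_trans ?_ (hbound s hs F
    (T.filter fun x => IntegrableOn (gStarDensity s F x) (Set.Ioi 0))
    fun x hx => (Finset.mem_filter.1 hx).2)
  rw [Finset.sum_filter]
  refine Finset.sum_le_sum fun x _ => ?_
  rw [abs_of_nonneg (sqrt_nonneg _)]
  split_ifs with hx
  · exact le_rfl
  · rw [integral_undef hx, sqrt_zero, zero_rpow (by linarith)]
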